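/- Let $n \geq 2$ be an integer and $\alpha > \tfrac{2-n}{2}$ a real number. For $\varepsilon \in (0,1)$ define the Lipschitz function $w_\varepsilon : (0,\infty) \to \mathbb{R}$ by $w_\varepsilon(r) = 0$ for $r \in (0, \varepsilon^2]$; $w_\varepsilon(r) = \varepsilon^\alpha\left(2 - \tfrac{\log r}{\log \varepsilon}\right)$ for $r \in (\varepsilon^2, \varepsilon]$; $w_\varepsilon(r) = r^\alpha$ for $r \in (\varepsilon, \varepsilon^{-1}]$; $w_\varepsilon(r) = \varepsilon^{-\alpha}(2 - \varepsilon r)$ for $r \in (\varepsilon^{-1}, 2\varepsilon^{-1}]$; and $w_\varepsilon(r) = 0$ for $r > 2\varepsilon^{-1}$. Then, as $\varepsilon \to 0^+$, $$\frac{\int_0^\infty \left( w_\varepsilon'(r)^2 - \left((n-1)r^{-2} + \tfrac{1}{2}\right) w_\varepsilon(r)^2 \right) e^{-r^2/4}\, r^{n-1}\, dr}{\int_0^\infty w_\varepsilon(r)^2\, e^{-r^2/4}\, r^{n-1}\, dr} \;\longrightarrow\; \frac{\alpha^2 - 2\alpha - 2n + 3}{2\,(n + 2\alpha - 2)}.$$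 -/

import Mathlib

open MeasureTheory Filter

/-- The Lipschitz logarithmic cutoff of `r ↦ r^α` used in the eigenvalue estimate:
`w ε = 0` on `(0, ε²]`, `= ε^α (2 - log r / log ε)` on `(ε², ε]`, `= r^α` on `(ε, ε⁻¹]`,
`= ε^{-α} (2 - ε r)` on `(ε⁻¹, 2 ε⁻¹]`, and `= 0` for `r > 2 ε⁻¹`. -/
noncomputable def cutoffW (α ε : ℝ) (r : ℝ) : ℝ :=
  if r ≤ ε ^ 2 then 0
  else if r ≤ ε then ε ^ α * (2 - Real.log r / Real.log ε)
  else if r ≤ ε⁻¹ then r ^ α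
  else if r ≤ 2 * ε⁻¹ then ε ^ (-α) * (2 - ε * r)
  else 0

theorem rpow_sq_le_of_sq_le_of_le {α ε r : ℝ} (hε : 0 < ε) (h₁ : ε ^ 2 ≤ r) (h₂ : r ≤ ε) :
    (ε ^ α) ^ 2 ≤ r ^ α + r ^ (2 * α) := by
  have hr : 0 < r := lt_of_lt_of_le (by positivity) h₁
  rcases le_total 0 α with h | h
  · have h3 : (ε ^ α) ^ 2 = (ε ^ 2) ^ α := (Real.rpow_pow_comm hε.le α 2)
    have h4 := Real.rpow_le_rpow (by positivity) h₁ h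
    have h5 : 0 < r ^ (2 * α) := by positivity
    linarith
  · have h3 : (ε ^ α) ^ 2 = ε ^ (2 * α) := by
      rw [← Real.rpow_mul_natCast hε.le, mul_comm]; norm_num
    have h4 := Real.rpow_le_rpow_of_nonpos hr h₂ (by linarith : 2 * α ≤ 0)
    have h5 : 0 < r ^ α := by positivity
    linarith

theorem rpow_neg_sq_le_of_inv_le_of_le_two_mul_inv {α ε r : ℝ} (hε : 0 < ε) (h₁ : ε⁻¹ ≤ r)
    (h₂ : r ≤ 2 * ε⁻¹) :
    (ε ^ (-α)) ^ 2 ≤ (1 + 2 ^ (-(2 * α))) * r ^ (2 * α) := by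
  have hx : 0 < ε⁻¹ := inv_pos.2 hε
  have hr : 0 < r := hx.trans_le h₁
  have h3 : (ε ^ (-α)) ^ 2 = ε⁻¹ ^ (2 * α) := by
    rw [← Real.rpow_mul_natCast hε.le, Real.inv_rpow hε.le, ← Real.rpow_neg hε.le]
    congr 1
    push_cast
    ring
  rw [h3]
  have h5 : 0 < r ^ (2 * α) := by positivity
  have h6 : (0 : ℝ) < 2 ^ (-(2 * α)) := by positivity
  rcases le_total 0 α with h | h
  · have h4 := Real.rpow_le_rpow hx.le h₁ (by linarith : 0 ≤ 2 * α)
    nlinarith [mul_pos h6 h5]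
  · have h4 := Real.rpow_le_rpow_of_nonpos (by linarith : 0 < r / 2)
      (by linarith : r / 2 ≤ ε⁻¹) (by linarith : 2 * α ≤ 0)
    rw [Real.div_rpow hr.le (by norm_num), div_eq_mul_inv, ← Real.rpow_neg (by norm_num)] at h4
    nlinarith

theorem cutoffW_sq_le {α ε r : ℝ} (hε : 0 < ε) (hlog : Real.log ε ≤ -1) (hr : 0 < r) :
    cutoffW α ε r ^ 2 ≤ (1 + 2 ^ (-(2 * α))) * (r ^ α + r ^ (2 * α)) := by
  have h5 : 0 < r ^ (2 * α) := by positivity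
  have h5' : 0 < r ^ α := by positivity
  have h6 : (0 : ℝ) < 2 ^ (-(2 * α)) := by positivity
  have h7 : r ^ α + r ^ (2 * α) ≤ (1 + 2 ^ (-(2 * α))) * (r ^ α + r ^ (2 * α)) := by
    nlinarith [mul_pos h6 h5, mul_pos h6 h5']
  unfold cutoffW
  split_ifs with h1 h2 h3 h4
  · rw [zero_pow two_ne_zero]
    positivity
  · rw [not_le] at h1
    have hl1 : Real.log r ≤ Real.log ε := Real.log_le_log hr h2
    have hl2 : 2 * Real.log ε ≤ Real.log r := by
      have := Real.log_le_log (by positivity) h1.le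
      rwa [Real.log_pow, Nat.cast_ofNat] at this
    have hq1 : 1 ≤ Real.log r / Real.log ε := (one_le_div_of_neg (by linarith)).2 hl1
    have hq2 : Real.log r / Real.log ε ≤ 2 := (div_le_iff_of_neg (by linarith)).2 hl2
    have := rpow_sq_le_of_sq_le_of_le (α := α) hε h1.le h2
    rw [mul_pow]
    have h8 : (2 - Real.log r / Real.log ε) ^ 2 ≤ 1 := by nlinarith
    nlinarith [mul_le_mul_of_nonneg_left h8 (sq_nonneg (ε ^ α))]
  · have : (r ^ α) ^ 2 = r ^ (2 * α) := by
      rw [← Real.rpow_mul_natCast hr.le, mul_comm]; norm_num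
    linarith
  · rw [not_le] at h3
    have := rpow_neg_sq_le_of_inv_le_of_le_two_mul_inv (α := α) hε h3.le h4
    have hq1 : 1 ≤ ε * r := by
      have := mul_le_mul_of_nonneg_left h3.le hε.le
      rwa [mul_inv_cancel₀ hε.ne'] at this
    have hq2 : ε * r ≤ 2 := by
      have := mul_le_mul_of_nonneg_left h4 hε.le
      rwa [mul_left_comm, mul_inv_cancel₀ hε.ne', mul_one] at this
    rw [mul_pow]
    have h8 : (2 - ε * r) ^ 2 ≤ 1 := by nlinarith
    nlinarith [mul_le_mul_of_nonneg_left h8 (sq_nonneg (ε ^ (-α))), mul_pos h6 h5']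
  · rw [zero_pow two_ne_zero]
    positivity

theorem eventuallyEq_cutoffW_rpow {α ε r : ℝ} (hε : 0 < ε) (hε1 : ε < 1) (h₁ : ε < r)
    (h₂ : r < ε⁻¹) : cutoffW α ε =ᶠ[nhds r] fun x => x ^ α := by
  filter_upwards [Ioo_mem_nhds h₁ h₂] with x hx
  have : ε ^ 2 < ε := by nlinarith
  simp [cutoffW, (this.trans hx.1).not_ge, hx.1.not_ge, hx.2.le]

theorem deriv_cutoffW_eq_rpow {α ε r : ℝ} (hε : 0 < ε) (hε1 : ε < 1) (h₁ : ε < r)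
    (h₂ : r < ε⁻¹) : deriv (cutoffW α ε) r = α * r ^ (α - 1) := by
  rw [(eventuallyEq_cutoffW_rpow hε hε1 h₁ h₂).deriv_eq]
  exact (Real.hasDerivAt_rpow_const (Or.inl (hε.trans h₁).ne')).deriv

theorem deriv_cutoffW_sq_le {α ε r : ℝ} (hε : 0 < ε) (hlog : Real.log ε ≤ -1) (hr : 0 < r)
    (hr₁ : r ≠ ε ^ 2) (hr₂ : r ≠ ε) (hr₃ : r ≠ ε⁻¹) (hr₄ : r ≠ 2 * ε⁻¹) :
    deriv (cutoffW α ε) r ^ 2 ≤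
      (4 + α ^ 2) * ((1 + 2 ^ (-(2 * α))) * (r ^ α + r ^ (2 * α)) * r ^ (-2 : ℝ)) := by
  have h5 : 0 < r ^ (2 * α) := by positivity
  have h5' : 0 < r ^ α := by positivity
  have h6 : (0 : ℝ) < 2 ^ (-(2 * α)) := by positivity
  have h7 : r ^ α + r ^ (2 * α) ≤ (1 + 2 ^ (-(2 * α))) * (r ^ α + r ^ (2 * α)) := by
    nlinarith [mul_pos h6 h5, mul_pos h6 h5']
  have hε1 : ε < 1 := by
    by_contra! h
    linarith [Real.log_nonneg h]
  have hx : 1 < ε⁻¹ := (one_lt_inv₀ hε).2 hε1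
  have hee : ε ^ 2 < ε := by nlinarith
  have hm2 : r ^ (-2 : ℝ) = (r ^ 2)⁻¹ := by
    rw [Real.rpow_neg hr.le]; norm_num
  set M := (1 + 2 ^ (-(2 * α))) * (r ^ α + r ^ (2 * α)) with hM
  have hM0 : 0 < M := by positivity
  have hR0 : 0 < r ^ (-2 : ℝ) := by positivity
  rcases lt_or_gt_of_ne hr₁ with h1 | h1
  · have : cutoffW α ε =ᶠ[nhds r] fun _ => 0 := by
      filter_upwards [Iio_mem_nhds h1] with x hx
      simp [cutoffW, (Set.mem_Iio.1 hx).le]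
    rw [this.deriv_eq]
    rw [deriv_const, zero_pow two_ne_zero]
    positivity
  rcases lt_or_gt_of_ne hr₂ with h2 | h2
  · have : cutoffW α ε =ᶠ[nhds r] fun x => ε ^ α * (2 - Real.log x / Real.log ε) := by
      filter_upwards [Ioo_mem_nhds h1 h2] with x hx
      simp [cutoffW, hx.1.not_ge, hx.2.le]
    have hd : HasDerivAt (fun x => ε ^ α * (2 - Real.log x / Real.log ε))
        (ε ^ α * (-(r⁻¹ / Real.log ε))) r :=
      (((Real.hasDerivAt_log hr.ne').div_const _).const_sub 2).const_mul _
    rw [this.deriv_eq, hd.deriv, hm2]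
    have hk := (rpow_sq_le_of_sq_le_of_le (α := α) hε h1.le h2.le).trans h7
    have hl : ((Real.log ε) ^ 2)⁻¹ ≤ 1 := inv_le_one_of_one_le₀ (by nlinarith)
    calc _ = (ε ^ α) ^ 2 * (r ^ 2)⁻¹ * ((Real.log ε) ^ 2)⁻¹ := by
          rw [mul_pow, neg_sq, div_pow, inv_pow]; ring
      _ ≤ M * (r ^ 2)⁻¹ * 1 := by gcongr
      _ ≤ _ := by
        have : 0 < M * (r ^ 2)⁻¹ := by positivity
        nlinarith [mul_nonneg (sq_nonneg α) this.le]
  rcases lt_or_gt_of_ne hr₃ with h3 | h3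
  · rw [deriv_cutoffW_eq_rpow hε hε1 h2 h3]
    have : (r ^ (α - 1)) ^ 2 = r ^ (2 * α) * r ^ (-2 : ℝ) := by
      rw [← Real.rpow_mul_natCast hr.le, ← Real.rpow_add hr]
      congr 1
      push_cast
      ring
    rw [mul_pow, this]
    have h8 : r ^ (2 * α) ≤ M := by linarith
    have h9 : r ^ (2 * α) * r ^ (-2 : ℝ) ≤ M * r ^ (-2 : ℝ) := by gcongr
    have h10 := mul_le_mul_of_nonneg_left h9 (sq_nonneg α)
    nlinarith [mul_pos hM0 hR0]
  rcases lt_or_gt_of_ne hr₄ with h4 | h4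
  · have : cutoffW α ε =ᶠ[nhds r] fun x => ε ^ (-α) * (2 - ε * x) := by
      filter_upwards [Ioo_mem_nhds h3 h4] with x hx
      have h8 : ε < x := by linarith [hx.1]
      simp [cutoffW, hx.1.not_ge, hx.2.le, h8.not_ge, (hee.trans h8).not_ge]
    have hd : HasDerivAt (fun x => ε ^ (-α) * (2 - ε * x)) (ε ^ (-α) * (-(ε * 1))) r :=
      (((hasDerivAt_id r).const_mul ε).const_sub 2).const_mul _
    rw [this.deriv_eq, hd.deriv, hm2]
    have hk := rpow_neg_sq_le_of_inv_le_of_le_two_mul_inv (α := α) hε h3.le h4.le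
    have hk' : (ε ^ (-α)) ^ 2 ≤ M := by
      rw [hM]; nlinarith [mul_pos h6 h5']
    have hq2 : ε * r ≤ 2 := by
      have := mul_le_mul_of_nonneg_left h4.le hε.le
      rwa [mul_left_comm, mul_inv_cancel₀ hε.ne', mul_one] at this
    have hq3 : ε ^ 2 ≤ 4 * (r ^ 2)⁻¹ := by
      rw [← div_eq_mul_inv, le_div_iff₀ (by positivity), ← mul_pow]
      nlinarith [mul_pos hε hr]
    calc _ = (ε ^ (-α)) ^ 2 * ε ^ 2 := by ring
      _ ≤ M * (4 * (r ^ 2)⁻¹) := by gcongr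
      _ ≤ _ := by
        have : 0 < M * (r ^ 2)⁻¹ := by positivity
        nlinarith [mul_nonneg (sq_nonneg α) this.le]
  · have : cutoffW α ε =ᶠ[nhds r] fun _ => 0 := by
      filter_upwards [Ioi_mem_nhds h4] with x hx
      have hx : 2 * ε⁻¹ < x := hx
      have h9 : ε⁻¹ < x := by linarith
      have h8 : ε < x := by linarith
      simp [cutoffW, hx.not_ge, h9.not_ge, h8.not_ge, (hee.trans h8).not_ge]
    rw [this.deriv_eq]
    rw [deriv_const, zero_pow two_ne_zero]
    positivity

theorem measurable_cutoffW (α ε : ℝ) : Measurable (cutoffW α ε) := by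
  unfold cutoffW
  refine Measurable.ite measurableSet_Iic measurable_const ?_
  refine Measurable.ite measurableSet_Iic (by fun_prop) ?_
  refine Measurable.ite measurableSet_Iic (by fun_prop) ?_
  exact Measurable.ite measurableSet_Iic (by fun_prop) measurable_const

theorem integrableOn_rpow_mul_exp_mul_pow {n : ℕ} (hn : 1 ≤ n) {s : ℝ} (hs : 0 < n + s) :
    IntegrableOn (fun r : ℝ => r ^ s * Real.exp (-r ^ 2 / 4) * r ^ (n - 1)) (Set.Ioi 0) := by
  refine (integrableOn_rpow_mul_exp_neg_mul_sq (b := 1 / 4) (by norm_num)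
    (s := s + (n - 1)) (by linarith)).congr_fun (fun r hr => ?_) measurableSet_Ioi
  have hr : 0 < r := hr
  have : r ^ (n - 1) = r ^ ((n : ℝ) - 1) := by
    rw [← Real.rpow_natCast, Nat.cast_sub hn, Nat.cast_one]
  beta_reduce
  rw [Real.rpow_add hr, this, show -(1 / 4) * r ^ 2 = -r ^ 2 / 4 by ring]
  ring

theorem integral_rpow_mul_exp_mul_pow {n : ℕ} (hn : 1 ≤ n) {s : ℝ} (hs : 0 < n + s) :
    ∫ r in Set.Ioi (0 : ℝ), r ^ s * Real.exp (-r ^ 2 / 4) * r ^ (n - 1) =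
      (1 / 4) ^ (-(n + s) / 2) * (1 / 2) * Real.Gamma ((n + s) / 2) := by
  have h := integral_rpow_mul_exp_neg_mul_rpow (p := 2) (q := s + (n - 1)) (b := 1 / 4)
    (by norm_num) (by linarith) (by norm_num)
  rw [show s + ((n : ℝ) - 1) + 1 = n + s by ring] at h
  rw [← h]
  refine setIntegral_congr_fun measurableSet_Ioi (fun r hr => ?_)
  have hr : 0 < r := hr
  have : r ^ (n - 1) = r ^ ((n : ℝ) - 1) := by
    rw [← Real.rpow_natCast, Nat.cast_sub hn, Nat.cast_one]
  rw [Real.rpow_add hr, this, Real.rpow_two, show -(1 / 4) * r ^ 2 = -r ^ 2 / 4 by ring]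
  ring

theorem integral_rpow_mul_exp_mul_pow_pos {n : ℕ} (hn : 1 ≤ n) {s : ℝ} (hs : 0 < n + s) :
    0 < ∫ r in Set.Ioi (0 : ℝ), r ^ s * Real.exp (-r ^ 2 / 4) * r ^ (n - 1) := by
  rw [integral_rpow_mul_exp_mul_pow hn hs]
  have := Real.Gamma_pos_of_pos (by linarith : 0 < (n + s) / 2)
  positivity

theorem integral_rpow_add_two_mul_exp_mul_pow {n : ℕ} (hn : 1 ≤ n) {s : ℝ} (hs : 0 < n + s) :
    ∫ r in Set.Ioi (0 : ℝ), r ^ (s + 2) * Real.exp (-r ^ 2 / 4) * r ^ (n - 1) =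
      2 * (n + s) * ∫ r in Set.Ioi (0 : ℝ), r ^ s * Real.exp (-r ^ 2 / 4) * r ^ (n - 1) := by
  rw [integral_rpow_mul_exp_mul_pow hn hs, integral_rpow_mul_exp_mul_pow hn (by linarith),
    show ((n : ℝ) + (s + 2)) / 2 = (n + s) / 2 + 1 by ring,
    Real.Gamma_add_one (by linarith),
    show -((n : ℝ) + (s + 2)) / 2 = -(n + s) / 2 - 1 by ring,
    Real.rpow_sub_one (by norm_num)]
  ring

/-- A common integrable bound for the integrands of both integrals in the quotient. -/
noncomputable def dominator (n : ℕ) (α r : ℝ) : ℝ :=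
  (1 + 2 ^ (-(2 * α))) * (r ^ α + r ^ (2 * α)) * (r ^ (-2 : ℝ) + 1) * Real.exp (-r ^ 2 / 4) *
    r ^ (n - 1)

theorem integrableOn_dominator {n : ℕ} (hn : 2 ≤ n) {α : ℝ} (hα : (2 - (n : ℝ)) / 2 < α) :
    IntegrableOn (dominator n α) (Set.Ioi 0) := by
  have hn' : (2 : ℝ) ≤ n := by exact_mod_cast hn
  have h1 : 1 ≤ n := by omega
  refine IntegrableOn.congr_fun
    ((((integrableOn_rpow_mul_exp_mul_pow h1 (s := α + -2) (by linarith)).add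
    (integrableOn_rpow_mul_exp_mul_pow h1 (s := 2 * α + -2) (by linarith))).add
    ((integrableOn_rpow_mul_exp_mul_pow h1 (s := α) (by linarith)).add
    (integrableOn_rpow_mul_exp_mul_pow h1 (s := 2 * α) (by linarith)))).const_mul
    (1 + 2 ^ (-(2 * α)))) (fun r hr => ?_) measurableSet_Ioi
  have hr : 0 < r := hr
  simp only [dominator, Pi.add_apply]
  rw [Real.rpow_add hr, Real.rpow_add hr]
  ring

theorem eventually_log_le_neg_one :
    ∀ᶠ ε in nhdsWithin (0 : ℝ) (Set.Ioo 0 1), 0 < ε ∧ ε < 1 ∧ Real.log ε ≤ -1 := by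
  filter_upwards [self_mem_nhdsWithin,
    mem_nhdsWithin_of_mem_nhds (Iio_mem_nhds (Real.exp_pos (-1)))] with ε h1 h2
  refine ⟨h1.1, h1.2, ?_⟩
  rw [Real.log_le_iff_le_exp h1.1]
  exact (Set.mem_Iio.1 h2).le

theorem eventually_lt_lt_inv {r : ℝ} (hr : 0 < r) :
    ∀ᶠ ε in nhdsWithin (0 : ℝ) (Set.Ioo 0 1), 0 < ε ∧ ε < 1 ∧ ε < r ∧ r < ε⁻¹ := by
  filter_upwards [self_mem_nhdsWithin, mem_nhdsWithin_of_mem_nhds (Iio_mem_nhds hr),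
    mem_nhdsWithin_of_mem_nhds (Iio_mem_nhds (inv_pos.2 hr))] with ε h1 h2 h3
  exact ⟨h1.1, h1.2, h2, (lt_inv_comm₀ hr h1.1).2 h3⟩

theorem tendsto_integral_cutoffW_sq {n : ℕ} (hn : 2 ≤ n) {α : ℝ}
    (hα : (2 - (n : ℝ)) / 2 < α) :
    Tendsto (fun ε : ℝ =>
        ∫ r in Set.Ioi (0 : ℝ), cutoffW α ε r ^ 2 * Real.exp (-r ^ 2 / 4) * r ^ (n - 1))
      (nhdsWithin 0 (Set.Ioo (0 : ℝ) 1))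
      (nhds (∫ r in Set.Ioi (0 : ℝ), (r ^ α) ^ 2 * Real.exp (-r ^ 2 / 4) * r ^ (n - 1))) := by
  refine tendsto_integral_filter_of_dominated_convergence (dominator n α) ?_ ?_
    (integrableOn_dominator hn hα) ?_
  · refine Eventually.of_forall fun ε => Measurable.aestronglyMeasurable ?_
    have := measurable_cutoffW α ε
    fun_prop
  · filter_upwards [eventually_log_le_neg_one] with ε ⟨hε, _, hlog⟩
    refine (ae_restrict_iff' measurableSet_Ioi).2 (Eventually.of_forall fun r hr => ?_)
    have hr : 0 < r := hr
    rw [Real.norm_of_nonneg (by positivity), dominator]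
    gcongr
    refine (cutoffW_sq_le hε hlog hr).trans (le_mul_of_one_le_right (by positivity) ?_)
    have : 0 < r ^ (-2 : ℝ) := by positivity
    linarith
  · refine (ae_restrict_iff' measurableSet_Ioi).2 (Eventually.of_forall fun r hr => ?_)
    refine tendsto_const_nhds.congr' ?_
    filter_upwards [eventually_lt_lt_inv hr] with ε ⟨h0, h1, h2, h3⟩
    rw [(eventuallyEq_cutoffW_rpow h0 h1 h2 h3).eq_of_nhds]

theorem tendsto_integral_deriv_cutoffW_sq_sub {n : ℕ} (hn : 2 ≤ n) {α : ℝ}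
    (hα : (2 - (n : ℝ)) / 2 < α) :
    Tendsto (fun ε : ℝ => ∫ r in Set.Ioi (0 : ℝ), (deriv (cutoffW α ε) r ^ 2 -
        (((n : ℝ) - 1) * r ^ (-2 : ℝ) + 1 / 2) * cutoffW α ε r ^ 2) *
          Real.exp (-r ^ 2 / 4) * r ^ (n - 1))
      (nhdsWithin 0 (Set.Ioo (0 : ℝ) 1))
      (nhds (∫ r in Set.Ioi (0 : ℝ), ((α * r ^ (α - 1)) ^ 2 -
        (((n : ℝ) - 1) * r ^ (-2 : ℝ) + 1 / 2) * (r ^ α) ^ 2) *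
          Real.exp (-r ^ 2 / 4) * r ^ (n - 1))) := by
  have hn' : (2 : ℝ) ≤ n := by exact_mod_cast hn
  refine tendsto_integral_filter_of_dominated_convergence
    (fun r => (4 + α ^ 2 + n) * dominator n α r) ?_ ?_
    ((integrableOn_dominator hn hα).const_mul _) ?_
  · refine Eventually.of_forall fun ε => Measurable.aestronglyMeasurable ?_
    have := measurable_cutoffW α ε
    have := measurable_deriv (cutoffW α ε)
    fun_prop
  · filter_upwards [eventually_log_le_neg_one] with ε ⟨hε, _, hlog⟩
    refine (ae_restrict_iff' measurableSet_Ioi).2 ?_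
    filter_upwards [Measure.ae_ne volume (ε ^ 2), Measure.ae_ne volume ε,
      Measure.ae_ne volume ε⁻¹, Measure.ae_ne volume (2 * ε⁻¹)] with r h1 h2 h3 h4 hr
    have hr : 0 < r := hr
    have hw := cutoffW_sq_le (α := α) hε hlog hr
    have hd := deriv_cutoffW_sq_le (α := α) hε hlog hr h1 h2 h3 h4
    rw [norm_mul, norm_mul, Real.norm_of_nonneg (Real.exp_pos _).le,
      Real.norm_of_nonneg (pow_pos hr _).le, dominator, ← mul_assoc, ← mul_assoc]
    gcongr
    have hM : 0 < (1 + 2 ^ (-(2 * α))) * (r ^ α + r ^ (2 * α)) := by positivity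
    set M := (1 + 2 ^ (-(2 * α))) * (r ^ α + r ^ (2 * α))
    have hR : 0 < r ^ (-2 : ℝ) := by positivity
    set R := r ^ (-2 : ℝ)
    have hc : 0 ≤ ((n : ℝ) - 1) * R + 1 / 2 := by
      have := mul_nonneg (by linarith : 0 ≤ (n : ℝ) - 1) hR.le
      linarith
    have hcw := mul_le_mul_of_nonneg_left hw hc
    have hcw0 := mul_nonneg hc (sq_nonneg (cutoffW α ε r))
    have hMR := mul_pos hM hR
    have hα2 := mul_nonneg (sq_nonneg α) hM.le
    have hα3 := mul_nonneg (sq_nonneg α) hMR.le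
    have hn1 := mul_nonneg (by linarith : 0 ≤ (n : ℝ) - 1) hM.le
    have hn2 := mul_nonneg (by linarith : 0 ≤ (n : ℝ) - 1) hMR.le
    rw [Real.norm_eq_abs, abs_le]
    constructor <;> nlinarith [sq_nonneg (deriv (cutoffW α ε) r)]
  · refine (ae_restrict_iff' measurableSet_Ioi).2 (Eventually.of_forall fun r hr => ?_)
    refine tendsto_const_nhds.congr' ?_
    filter_upwards [eventually_lt_lt_inv hr] with ε ⟨h0, h1, h2, h3⟩
    rw [(eventuallyEq_cutoffW_rpow h0 h1 h2 h3).eq_of_nhds, deriv_cutoffW_eq_rpow h0 h1 h2 h3]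

theorem rayleigh_quotient_limit (n : ℕ) (hn : 2 ≤ n) (α : ℝ)
    (hα : (2 - (n : ℝ)) / 2 < α) :
    Filter.Tendsto
      (fun ε : ℝ =>
        (∫ r in Set.Ioi (0 : ℝ),
            (deriv (cutoffW α ε) r ^ 2 -
              (((n : ℝ) - 1) * r ^ (-2 : ℝ) + 1 / 2) * cutoffW α ε r ^ 2) *
              Real.exp (-r ^ 2 / 4) * r ^ (n - 1)) /
          (∫ r in Set.Ioi (0 : ℝ), cutoffW α ε r ^ 2 * Real.exp (-r ^ 2 / 4) * r ^ (n - 1)))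
      (nhdsWithin 0 (Set.Ioo (0 : ℝ) 1))
      (nhds ((α ^ 2 - 2 * α - 2 * (n : ℝ) + 3) / (2 * ((n : ℝ) + 2 * α - 2)))) := by
  have hn' : (2 : ℝ) ≤ n := by exact_mod_cast hn
  have h1 : 1 ≤ n := by omega
  have hs : 0 < (n : ℝ) + (2 * α - 2) := by linarith
  have hpow : ∀ r ∈ Set.Ioi (0 : ℝ), (r ^ α) ^ 2 = r ^ (2 * α - 2 + 2) := fun r hr => by
    rw [← Real.rpow_mul_natCast (le_of_lt hr)]
    congr 1
    push_cast
    ring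
  have hI := integrableOn_rpow_mul_exp_mul_pow h1 hs
  have hI2 := integrableOn_rpow_mul_exp_mul_pow h1 (s := 2 * α - 2 + 2) (by linarith)
  have hpos := integral_rpow_mul_exp_mul_pow_pos h1 hs
  have hrec := integral_rpow_add_two_mul_exp_mul_pow h1 hs
  have hden : ∫ r in Set.Ioi (0 : ℝ), (r ^ α) ^ 2 * Real.exp (-r ^ 2 / 4) * r ^ (n - 1) =
      ∫ r in Set.Ioi (0 : ℝ), r ^ (2 * α - 2 + 2) * Real.exp (-r ^ 2 / 4) * r ^ (n - 1) :=
    setIntegral_congr_fun measurableSet_Ioi fun r hr => by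
      rw [hpow r hr]
  have hnum : ∫ r in Set.Ioi (0 : ℝ), ((α * r ^ (α - 1)) ^ 2 -
        (((n : ℝ) - 1) * r ^ (-2 : ℝ) + 1 / 2) * (r ^ α) ^ 2) *
          Real.exp (-r ^ 2 / 4) * r ^ (n - 1) =
      (α ^ 2 - (n - 1)) *
        (∫ r in Set.Ioi (0 : ℝ), r ^ (2 * α - 2) * Real.exp (-r ^ 2 / 4) * r ^ (n - 1)) -
      1 / 2 *
        ∫ r in Set.Ioi (0 : ℝ), r ^ (2 * α - 2 + 2) * Real.exp (-r ^ 2 / 4) * r ^ (n - 1) := by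
    rw [← integral_const_mul, ← integral_const_mul,
      ← integral_sub (hI.const_mul _) (hI2.const_mul _)]
    refine setIntegral_congr_fun measurableSet_Ioi fun r hr => ?_
    have e1 : (r ^ (α - 1)) ^ 2 = r ^ (2 * α - 2) := by
      rw [← Real.rpow_mul_natCast (le_of_lt hr)]
      congr 1
      push_cast
      ring
    have e2 : r ^ (-2 : ℝ) * r ^ (2 * α - 2 + 2) = r ^ (2 * α - 2) := by
      rw [← Real.rpow_add hr]
      congr 1
      ring
    rw [hpow r hr, mul_pow, e1, ← e2]
    ring
  have hlim := (tendsto_integral_deriv_cutoffW_sq_sub hn hα).div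
    (tendsto_integral_cutoffW_sq hn hα) (by
      rw [hden, hrec]
      positivity)
  rw [hden, hnum, hrec] at hlim
  refine (congrArg (fun c => Tendsto _ _ (nhds c)) ?_).mp hlim
  have hA : (n : ℝ) + 2 * α - 2 ≠ 0 := by linarith
  have hA' : (n : ℝ) + (2 * α - 2) ≠ 0 := hs.ne'
  have hJ := hpos.ne'
  generalize ∫ r in Set.Ioi (0 : ℝ), r ^ (2 * α - 2) * Real.exp (-r ^ 2 / 4) * r ^ (n - 1) = J
    at hJ ⊢
  field_simp
  ring
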